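/- arXiv:1401.5730 — 8 statements merged into one kernel-verified Lean document; each statement's English description precedes it below -/
import Mathlib

section
/- Let G be a finite connected loopless multigraph and let t be a nontrivial principal divisor on G. Then there exist an integer m ≥ 1 and pairwise disjoint subsets Z_0, Z_1, …, Z_m of the vertex set V with Z_0 ∪ Z_1 ∪ … ∪ Z_m = V, Z_0 ≠ ∅ and Z_m ≠ ∅, such that t = Σ_{i=0}^{m} i · t_{Z_i}. -/
open Finset

variable {V : Type*} [Fintype V] [DecidableEq V]

/-- Intersection number `v · A`. -/
def dot (m : V → V → ℕ) (v : V) (A : Finset V) : ℤ := ∑ w ∈ A, (m v w : ℤ)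

/-- The principal divisor `t_Z` associated to a set of vertices `Z`. -/
def tdiv (m : V → V → ℕ) (Z : Finset V) : V → ℤ :=
  fun v => if v ∈ Z then -(dot m v Zᶜ) else dot m v Z

/-- The subgroup of principal divisors of the multigraph `(V, m)`. -/
def Prin (m : V → V → ℕ) : AddSubgroup (V → ℤ) :=
  AddSubgroup.closure (Set.range (tdiv m))

/-- A divisor is effective if all its values are nonnegative. -/
def Effective (d : V → ℤ) : Prop := ∀ v, 0 ≤ d v

/-- The degree of a divisor. -/
def deg (d : V → ℤ) : ℤ := ∑ v, d v

/-- `d` is linearly equivalent to an effective divisor. -/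
def EquivEff (m : V → V → ℕ) (d : V → ℤ) : Prop :=
  ∃ e : V → ℤ, Effective e ∧ d - e ∈ Prin m

/-- The Baker–Norine combinatorial rank of a divisor on a weightless loopless
multigraph: `-1` if `d` is not equivalent to an effective divisor, and otherwise
the largest `k ≥ 0` such that for every effective divisor `e` of degree `k`,
`d - e` is equivalent to an effective divisor. -/
noncomputable def bnrank (m : V → V → ℕ) (d : V → ℤ) : ℤ :=
  sSup ({-1} ∪ {k : ℤ | 0 ≤ k ∧
    ∀ e : V → ℤ, Effective e → deg e = k → EquivEff m (d - e)})

/-- Connectedness: any two vertices are joined by a path of edges of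
positive multiplicity. -/
def Conn (m : V → V → ℕ) : Prop :=
  ∀ v w : V, Relation.ReflTransGen (fun a b => 0 < m a b) v w

/-- `d` is `u`-reduced. -/
def Reduced (m : V → V → ℕ) (u : V) (d : V → ℤ) : Prop :=
  (∀ v, v ≠ u → 0 ≤ d v) ∧
  ∀ A : Finset V, A.Nonempty → u ∉ A → ∃ v ∈ A, d v < dot m v Aᶜ

open Classical in
/-- `ℓ_G(d)` for a weightless graph: the minimum value of `d` if `d` is
effective, and `-1` otherwise. -/
noncomputable def ell [Nonempty V] (d : V → ℤ) : ℤ :=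
  if Effective d then Finset.univ.inf' Finset.univ_nonempty d else -1

/-- Edge multiplicities of the weightless loopless graph `Ĝ` associated to the
weighted graph `(V, m, g)`: for each `v` we add `g v` new vertices, each joined
to `v` by two edges. -/
def hatm (m : V → V → ℕ) (g : V → ℕ) :
    (V ⊕ Σ v : V, Fin (g v)) → (V ⊕ Σ v : V, Fin (g v)) → ℕ
  | Sum.inl v, Sum.inl w => m v w
  | Sum.inl v, Sum.inr z => if z.1 = v then 2 else 0
  | Sum.inr z, Sum.inl w => if z.1 = w then 2 else 0
  | Sum.inr _, Sum.inr _ => 0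

/-- Extension of a divisor on `G` to `Ĝ` by zero on the new vertices. -/
def hatd (g : V → ℕ) (d : V → ℤ) : (V ⊕ Σ v : V, Fin (g v)) → ℤ :=
  Sum.elim d fun _ => 0

/-- The combinatorial rank of a divisor on the weighted graph `(V, m, g)`,
defined as the Baker–Norine rank of its extension to `Ĝ`. -/
noncomputable def wrank (m : V → V → ℕ) (g : V → ℕ) (d : V → ℤ) : ℤ :=
  bnrank (hatm m g) (hatd g d)

/-- `e^deg`, for an effective divisor `e` on a weighted graph. -/
def edeg (g : V → ℕ) (e : V → ℤ) : V → ℤ :=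
  fun v => e v + min (e v) (g v : ℤ)

/-- `d_rk(v) = max (d v - g v) ⌊d v / 2⌋` (note `/` is floor division since
the divisor `2` is positive). -/
def drk (g : V → ℕ) (d : V → ℤ) : V → ℤ :=
  fun v => max (d v - (g v : ℤ)) (d v / 2)

open Classical in
/-- `ℓ_G(d)` for a weighted graph. -/
noncomputable def ellw [Nonempty V] (g : V → ℕ) (d : V → ℤ) : ℤ :=
  if Effective d then Finset.univ.inf' Finset.univ_nonempty (drk g d) else -1

/-- The graph Laplacian with multiplicities `m`, acting additively on integer-valued functions. -/
def laplacianHom (m : V → V → ℕ) : (V → ℤ) →+ (V → ℤ) where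
  toFun f := fun v => ∑ w, (m v w : ℤ) * (f w - f v)
  map_zero' := by ext v; simp
  map_add' f g := by
    ext v
    simp only [Pi.add_apply, ← Finset.sum_add_distrib]
    exact Finset.sum_congr rfl fun w _ => by ring

omit [DecidableEq V] in
theorem laplacianHom_apply (m : V → V → ℕ) (f : V → ℤ) (v : V) :
    laplacianHom m f v = ∑ w, (m v w : ℤ) * (f w - f v) := rfl

omit [DecidableEq V] in
theorem laplacianHom_const (m : V → V → ℕ) (c : ℤ) :
    laplacianHom m (fun _ => c) = 0 := by
  ext v
  simp [laplacianHom_apply]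

theorem tdiv_eq_laplacianHom (m : V → V → ℕ) (Z : Finset V) :
    tdiv m Z = laplacianHom m (fun v => if v ∈ Z then 1 else 0) := by
  ext v
  rw [laplacianHom_apply]
  by_cases hv : v ∈ Z
  · simp only [tdiv, dot, hv, if_true]
    rw [← Finset.sum_neg_distrib, ← Finset.sum_subset (Finset.subset_univ Zᶜ)]
    · refine Finset.sum_congr rfl fun w hw => ?_
      simp [Finset.mem_compl.mp hw]
    · intro w _ hw
      have : w ∈ Z := by simpa using hw
      simp [this]
  · simp [tdiv, dot, hv]

theorem exists_laplacianHom_eq_of_mem_Prin {m : V → V → ℕ} {t : V → ℤ} (ht : t ∈ Prin m) :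
    ∃ f : V → ℤ, laplacianHom m f = t := by
  have hle : Prin m ≤ (laplacianHom m).range := by
    rw [Prin, AddSubgroup.closure_le]
    rintro _ ⟨Z, rfl⟩
    exact ⟨_, (tdiv_eq_laplacianHom m Z).symm⟩
  exact hle ht

/-- Any nontrivial principal divisor `t` on a finite connected loopless
multigraph can be written as `t = ∑_{i=0}^M i · t_{Z_i}` for a partition
`V = Z_0 ⊔ … ⊔ Z_M` with `M ≥ 1`, `Z_0 ≠ ∅` and `Z_M ≠ ∅`. -/
theorem stmt0 {V : Type*} [Fintype V] [DecidableEq V] [Nonempty V]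
    (m : V → V → ℕ) (hsymm : ∀ v w, m v w = m w v) (hloop : ∀ v, m v v = 0)
    (hconn : Conn m)
    (t : V → ℤ) (ht : t ∈ Prin m) (hnt : t ≠ 0) :
    ∃ M : ℕ, 1 ≤ M ∧ ∃ Z : Fin (M + 1) → Finset V,
      (∀ i j, i ≠ j → Disjoint (Z i) (Z j)) ∧
      Finset.univ.biUnion Z = Finset.univ ∧
      (Z 0).Nonempty ∧ (Z (Fin.last M)).Nonempty ∧
      t = ∑ i : Fin (M + 1), ((i : ℕ) : ℤ) • tdiv m (Z i) := by
  obtain ⟨f, rfl⟩ := exists_laplacianHom_eq_of_mem_Prin ht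
  obtain ⟨a, ha⟩ := Finite.exists_min f
  obtain ⟨b, hb⟩ := Finite.exists_max f
  have hlt : f a < f b := by
    refine lt_of_le_of_ne (ha b) fun hab => hnt ?_
    have hf : f = fun _ => f a := by
      ext v
      exact le_antisymm (hab ▸ hb v) (ha v)
    rw [hf, laplacianHom_const]
  have hM : ((f b - f a).toNat : ℤ) = f b - f a := Int.toNat_of_nonneg (by omega)
  refine ⟨(f b - f a).toNat, by omega,
    fun i => Finset.univ.filter fun v => f v - f a = ((i : ℕ) : ℤ), ?_, ?_, ?_, ?_, ?_⟩
  · intro i j hij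
    rw [Finset.disjoint_left]
    intro v hi hj
    simp only [Finset.mem_filter, Finset.mem_univ, true_and] at hi hj
    exact hij (Fin.ext (by omega))
  · ext v
    have h₁ := ha v
    have h₂ := hb v
    simp only [Finset.mem_biUnion, Finset.mem_filter, Finset.mem_univ, true_and, iff_true]
    exact ⟨⟨(f v - f a).toNat, by omega⟩, by simp only; omega⟩
  · exact ⟨a, by simp⟩
  · exact ⟨b, by simp [hM]⟩
  · simp only [tdiv_eq_laplacianHom, ← map_zsmul, ← map_sum]
    have hf : f = (fun v => f v - f a) + fun _ => f a := by ext v; simp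
    conv_lhs => rw [hf, map_add, laplacianHom_const, add_zero]
    congr 1
    ext v
    have h₁ := ha v
    have h₂ := hb v
    rw [Finset.sum_apply, Finset.sum_eq_single ⟨(f v - f a).toNat, by omega⟩]
    · simp [h₁]
    · intro i _ hi
      have : f v - f a ≠ ((i : ℕ) : ℤ) := fun h => hi (Fin.ext (by simp only; omega))
      simp [this]
    · simp
end

section
/- Let G be a finite connected loopless multigraph and let t be a nontrivial principal divisor on G. Then there exists a nonempty proper subset Z ⊊ V such that for every vertex v ∈ Z one has t(v) ≤ t_Z(v), that is, t(v) ≤ −(v·(V∖Z)). -/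
open Finset

variable {V : Type*} [Fintype V] [DecidableEq V]

/-- Every principal divisor is the graph Laplacian of an integer-valued function. -/
theorem exists_laplacian_of_mem_Prin {V : Type*} [Fintype V] [DecidableEq V]
    (m : V → V → ℕ) {t : V → ℤ} (ht : t ∈ Prin m) :
    ∃ f : V → ℤ, ∀ v, t v = ∑ w, (m v w : ℤ) * (f w - f v) := by
  unfold Prin at ht
  induction ht using AddSubgroup.closure_induction with
  | mem x hx =>
    obtain ⟨Z, rfl⟩ := hx
    refine ⟨fun w => if w ∈ Z then 1 else 0, fun v => ?_⟩
    by_cases hv : v ∈ Z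
    · rw [← Finset.sum_add_sum_compl Z, Finset.sum_eq_zero (s := Z) (by simp +contextual [hv])]
      simp only [tdiv, dot, hv, if_true, zero_add, ← Finset.sum_neg_distrib]
      exact Finset.sum_congr rfl fun w hw => by simp [Finset.mem_compl.1 hw]
    · rw [← Finset.sum_add_sum_compl Z, Finset.sum_eq_zero (s := Zᶜ) (by simp +contextual [hv])]
      simp only [tdiv, dot, hv, if_false, add_zero]
      exact Finset.sum_congr rfl fun w hw => by simp [hw]
  | zero => exact ⟨0, by simp⟩
  | add x y _ _ hx hy =>
    obtain ⟨f, hf⟩ := hx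
    obtain ⟨g, hg⟩ := hy
    refine ⟨f + g, fun v => ?_⟩
    rw [Pi.add_apply, hf, hg, ← Finset.sum_add_distrib]
    exact Finset.sum_congr rfl fun w _ => by simp only [Pi.add_apply]; ring
  | neg x _ hx =>
    obtain ⟨f, hf⟩ := hx
    refine ⟨-f, fun v => ?_⟩
    rw [Pi.neg_apply, hf, ← Finset.sum_neg_distrib]
    exact Finset.sum_congr rfl fun w _ => by simp only [Pi.neg_apply]; ring

/-- For any nontrivial principal divisor `t` there is a nonempty proper subset
`Z ⊊ V` such that `t(v) ≤ t_Z(v) = -(v·(V∖Z))` for every `v ∈ Z`. -/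
theorem stmt1 {V : Type*} [Fintype V] [DecidableEq V] [Nonempty V]
    (m : V → V → ℕ) (hsymm : ∀ v w, m v w = m w v) (hloop : ∀ v, m v v = 0)
    (hconn : Conn m)
    (t : V → ℤ) (ht : t ∈ Prin m) (hnt : t ≠ 0) :
    ∃ Z : Finset V, Z.Nonempty ∧ Z ≠ Finset.univ ∧
      ∀ v ∈ Z, t v ≤ -(dot m v Zᶜ) := by
  obtain ⟨f, hf⟩ := exists_laplacian_of_mem_Prin m ht
  obtain ⟨a, ha⟩ := Finite.exists_max f
  refine ⟨Finset.univ.filter fun v => f v = f a, ⟨a, by simp⟩, fun hZ => hnt ?_, fun v hv => ?_⟩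
  · have hconst : ∀ v, f v = f a := by simpa [Finset.filter_eq_self] using hZ
    funext v
    simp [hf, hconst]
  · have hva : f v = f a := by simpa using hv
    rw [hf, dot, ← Finset.sum_neg_distrib,
      ← Finset.sum_add_sum_compl (Finset.univ.filter fun v => f v = f a),
      Finset.sum_eq_zero (s := Finset.univ.filter fun v => f v = f a)
        (by simp +contextual [hva]), zero_add]
    refine Finset.sum_le_sum fun w hw => ?_
    have hwa : f w ≠ f a := by simpa using hw
    have hlt : f w < f a := lt_of_le_of_ne (ha w) hwa
    nlinarith [Int.natCast_nonneg (m v w)]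
end

section
/- Let G be a weighted graph with associated weightless graph Ĝ. Then the extension-by-zero map Div(G) → Div(Ĝ), d ↦ d̂, is an injective group homomorphism mapping Prin(G) into Prin(Ĝ), and the induced homomorphism Pic(G) → Pic(Ĝ) is injective; that is, for divisors d, d′ on G one has d̂ − d̂′ ∈ Prin(Ĝ) if and only if d − d′ ∈ Prin(G). -/
open Finset

variable {V : Type*} [Fintype V] [DecidableEq V]

/-- The (negative) graph Laplacian of the multigraph `(V, m)`, as a group homomorphism. -/
def laplacian {V : Type*} [Fintype V] (m : V → V → ℕ) : (V → ℤ) →+ (V → ℤ) where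
  toFun f v := ∑ w, (m v w : ℤ) * (f w - f v)
  map_zero' := by ext; simp
  map_add' f f' := by
    ext v
    simp only [Pi.add_apply, ← Finset.sum_add_distrib]
    exact Finset.sum_congr rfl fun w _ => by ring

lemma laplacian_apply {V : Type*} [Fintype V] (m : V → V → ℕ) (f : V → ℤ) (v : V) :
    laplacian m f v = ∑ w, (m v w : ℤ) * (f w - f v) := rfl

lemma laplacian_indicator {V : Type*} [Fintype V] [DecidableEq V] (m : V → V → ℕ)
    (Z : Finset V) : laplacian m (fun v => if v ∈ Z then 1 else 0) = tdiv m Z := by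
  ext v
  by_cases hv : v ∈ Z
  · rw [laplacian_apply, ← Finset.sum_add_sum_compl Z,
      Finset.sum_eq_zero fun w hw => by simp [hw, hv], zero_add]
    simp only [tdiv, dot, hv, if_true, ← Finset.sum_neg_distrib]
    refine Finset.sum_congr rfl fun w hw => ?_
    simp [Finset.mem_compl.mp hw]
  · simp [laplacian_apply, tdiv, dot, hv]

lemma prin_eq_range_laplacian {V : Type*} [Fintype V] [DecidableEq V] (m : V → V → ℕ) :
    Prin m = (laplacian m).range := by
  refine le_antisymm ((AddSubgroup.closure_le _).mpr ?_) ?_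
  · rintro _ ⟨Z, rfl⟩
    exact ⟨_, laplacian_indicator m Z⟩
  · rintro _ ⟨f, rfl⟩
    have hf : f = ∑ v, f v • fun w => if w ∈ ({v} : Finset V) then (1 : ℤ) else 0 := by
      ext w
      simp [Finset.sum_apply]
    rw [hf, map_sum]
    refine sum_mem fun v _ => ?_
    rw [map_zsmul, laplacian_indicator]
    exact zsmul_mem (AddSubgroup.subset_closure (Set.mem_range_self _)) _

lemma laplacian_hatm_inr {V : Type*} [Fintype V] [DecidableEq V] (m : V → V → ℕ) (g : V → ℕ)
    (F : (V ⊕ Σ v : V, Fin (g v)) → ℤ) (z : Σ v : V, Fin (g v)) :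
    laplacian (hatm m g) F (Sum.inr z) = 2 * (F (Sum.inl z.1) - F (Sum.inr z)) := by
  simp [laplacian_apply, Fintype.sum_sum_type, hatm]

/-- If a function on `Ĝ` is constant along the added edges, its Laplacian is the extension by zero
of the Laplacian of its restriction to `G`. -/
lemma laplacian_hatm_of_eq {V : Type*} [Fintype V] [DecidableEq V] (m : V → V → ℕ) (g : V → ℕ)
    (F : (V ⊕ Σ v : V, Fin (g v)) → ℤ) (hF : ∀ z, F (Sum.inr z) = F (Sum.inl z.1)) :
    laplacian (hatm m g) F = hatd g (laplacian m (F ∘ Sum.inl)) := by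
  ext (v | z)
  · simp only [laplacian_apply, Fintype.sum_sum_type, hatm, hatd, Sum.elim_inl,
      Function.comp_apply, add_eq_left]
    refine Finset.sum_eq_zero fun z _ => ?_
    by_cases h : z.1 = v
    · simp [hF, h]
    · simp [h]
  · simp [laplacian_hatm_inr, hF, hatd]

lemma hatd_mem_prin_iff {V : Type*} [Fintype V] [DecidableEq V] (m : V → V → ℕ) (g : V → ℕ)
    (d : V → ℤ) : hatd g d ∈ Prin (hatm m g) ↔ d ∈ Prin m := by
  simp only [prin_eq_range_laplacian, AddMonoidHom.mem_range]
  constructor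
  · rintro ⟨F, hF⟩
    have hz (z) : F (Sum.inr z) = F (Sum.inl z.1) := by
      have h := congrFun hF (Sum.inr z)
      simp only [laplacian_hatm_inr, hatd, Sum.elim_inr] at h
      lia
    rw [laplacian_hatm_of_eq m g F hz] at hF
    exact ⟨F ∘ Sum.inl, funext fun v => congrFun hF (Sum.inl v)⟩
  · rintro ⟨f, rfl⟩
    exact ⟨Sum.elim f fun z => f z.1, laplacian_hatm_of_eq m g _ fun _ => rfl⟩

/-- The extension-by-zero map `Div(G) → Div(Ĝ)` is an injective group
homomorphism mapping `Prin(G)` into `Prin(Ĝ)`, and the induced map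
`Pic(G) → Pic(Ĝ)` is injective: `d̂ - d̂' ∈ Prin(Ĝ) ↔ d - d' ∈ Prin(G)`. -/
theorem stmt2 {V : Type*} [Fintype V] [DecidableEq V] [Nonempty V]
    (m : V → V → ℕ) (hsymm : ∀ v w, m v w = m w v) (hloop : ∀ v, m v v = 0)
    (hconn : Conn m) (g : V → ℕ) :
    Function.Injective (hatd g : (V → ℤ) → (V ⊕ Σ v : V, Fin (g v)) → ℤ) ∧
    (∀ d d' : V → ℤ, hatd g (d + d') = hatd g d + hatd g d') ∧
    (∀ t ∈ Prin m, hatd g t ∈ Prin (hatm m g)) ∧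
    (∀ d d' : V → ℤ,
      hatd g d - hatd g d' ∈ Prin (hatm m g) ↔ d - d' ∈ Prin m) := by
  refine ⟨fun d d' h => funext fun v => congrFun h (Sum.inl v), fun d d' => ?_,
    fun t ht => (hatd_mem_prin_iff m g t).mpr ht, fun d d' => ?_⟩
  · ext (v | z) <;> simp [hatd]
  · rw [← hatd_mem_prin_iff m g]
    have h : hatd g (d - d') = hatd g d - hatd g d' := by
      ext (v | z) <;> simp [hatd]
    rw [h]
end

section
/- Let G be a weighted graph, let d be a divisor on G, and let r ≥ 0 be an integer. Suppose that for every effective divisor e on G of degree r the divisor d − e^deg is equivalent to an effective divisor on G. Then r_G(d) ≥ r. -/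
open Finset

variable {V : Type*} [Fintype V] [DecidableEq V]

theorem tdiv_eq_sum (m : V → V → ℕ) (Z : Finset V) (v : V) :
    tdiv m Z v =
      ∑ w, (m v w : ℤ) * ((if w ∈ Z then 1 else 0) - (if v ∈ Z then 1 else 0)) := by
  by_cases hv : v ∈ Z
  · rw [← Finset.sum_add_sum_compl Z,
      Finset.sum_eq_zero fun w hw => by simp [hv, hw], zero_add, tdiv, if_pos hv, dot,
      ← Finset.sum_neg_distrib]
    exact Finset.sum_congr rfl fun w hw => by simp [hv, Finset.mem_compl.mp hw]
  · simp [tdiv, dot, hv]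

theorem deg_tdiv (m : V → V → ℕ) (hsymm : ∀ v w, m v w = m w v) (Z : Finset V) :
    deg (tdiv m Z) = 0 := by
  have key : ∑ v ∈ Zᶜ, dot m v Z = ∑ v ∈ Z, dot m v Zᶜ := by
    unfold dot
    rw [Finset.sum_comm]
    exact Finset.sum_congr rfl fun v _ => Finset.sum_congr rfl fun w _ => by rw [hsymm]
  have hin : ∑ v ∈ Z, tdiv m Z v = -∑ v ∈ Z, dot m v Zᶜ := by
    rw [← Finset.sum_neg_distrib]
    exact Finset.sum_congr rfl fun v hv => by simp [tdiv, hv]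
  have hout : ∑ v ∈ Zᶜ, tdiv m Z v = ∑ v ∈ Zᶜ, dot m v Z :=
    Finset.sum_congr rfl fun v hv => by simp [tdiv, Finset.mem_compl.mp hv]
  rw [deg, ← Finset.sum_add_sum_compl Z, hin, hout, key, neg_add_cancel]

theorem deg_eq_zero_of_mem_Prin (m : V → V → ℕ) (hsymm : ∀ v w, m v w = m w v)
    {p : V → ℤ} (hp : p ∈ Prin m) : deg p = 0 := by
  induction hp using AddSubgroup.closure_induction with
  | mem x hx =>
    obtain ⟨Z, rfl⟩ := hx
    exact deg_tdiv m hsymm Z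
  | zero => simp [deg]
  | add x y _ _ hx hy =>
    simp only [deg, Pi.add_apply, Finset.sum_add_distrib] at *
    omega
  | neg x _ hx =>
    simp only [deg, Pi.neg_apply, Finset.sum_neg_distrib] at *
    omega

theorem bddAbove_rank_set [Nonempty V] (m : V → V → ℕ) (hsymm : ∀ v w, m v w = m w v)
    (d : V → ℤ) :
    BddAbove ({-1} ∪ {k : ℤ | 0 ≤ k ∧
      ∀ e : V → ℤ, Effective e → deg e = k → EquivEff m (d - e)}) := by
  refine ⟨max (-1) (deg d), ?_⟩
  rintro k (rfl | ⟨hk, H⟩)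
  · exact le_max_left _ _
  · refine le_max_of_le_right ?_
    let u : V := Classical.arbitrary V
    have hdeg : deg (Pi.single u k) = k := by simp [deg]
    obtain ⟨f, hf, hp⟩ := H (Pi.single u k) (fun v => by
      by_cases hv : v = u
      · subst hv; simpa using hk
      · simp [hv]) hdeg
    have hzero := deg_eq_zero_of_mem_Prin m hsymm hp
    have hfdeg : 0 ≤ deg f := Finset.sum_nonneg fun v _ => hf v
    simp only [deg, Pi.sub_apply, Finset.sum_sub_distrib] at *
    omega

theorem hatm_symm {W : Type*} [DecidableEq W] (m : W → W → ℕ)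
    (hsymm : ∀ v w, m v w = m w v) (g : W → ℕ) :
    ∀ x y, hatm m g x y = hatm m g y x := by
  rintro (v | z) (w | y) <;> simp [hatm, hsymm]

/-- Extending a subset of `V` by all new vertices attached to it commutes with
taking principal divisors. -/
theorem hatd_tdiv (m : V → V → ℕ) (g : V → ℕ) (Z : Finset V) :
    hatd g (tdiv m Z) =
      tdiv (hatm m g) (Z.disjSum (Finset.univ.filter fun z => z.1 ∈ Z)) := by
  funext x
  rcases x with v | z
  · rw [tdiv_eq_sum, Fintype.sum_sum_type, Finset.sum_eq_zero (s := (Finset.univ : Finset (Σ v, _)))]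
    · simp [hatd, tdiv_eq_sum, hatm]
    · intro z _
      by_cases hz : z.1 = v <;> simp [hatm, hz]
  · rw [tdiv_eq_sum, Finset.sum_eq_zero]
    · rfl
    · rintro (w | y) _
      · by_cases hz : z.1 = w <;> simp [hatm, hz]
      · simp [hatm]

theorem hatd_mem_Prin (m : V → V → ℕ) (g : V → ℕ) {p : V → ℤ} (hp : p ∈ Prin m) :
    hatd g p ∈ Prin (hatm m g) := by
  induction hp using AddSubgroup.closure_induction with
  | mem x hx =>
    obtain ⟨Z, rfl⟩ := hx
    rw [hatd_tdiv]
    exact AddSubgroup.subset_closure ⟨_, rfl⟩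
  | zero =>
    convert (Prin (hatm m g)).zero_mem using 1
    funext x
    cases x <;> simp [hatd]
  | add x y _ _ hx hy =>
    convert (Prin (hatm m g)).add_mem hx hy using 1
    funext x
    cases x <;> simp [hatd]
  | neg x _ hx =>
    convert (Prin (hatm m g)).neg_mem hx using 1
    funext x
    cases x <;> simp [hatd]

theorem tdiv_singleton_inr (m : V → V → ℕ) (g : V → ℕ) (z : Σ v : V, Fin (g v)) :
    tdiv (hatm m g) {Sum.inr z} =
      Sum.elim (fun v => if z.1 = v then 2 else 0) (fun y => if y = z then -2 else 0) := by
  funext x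
  rcases x with v | y
  · simp [tdiv, dot, hatm]
  · by_cases hy : y = z
    · subst hy
      simp [tdiv_eq_sum, hatm]
    · simp [tdiv, dot, hatm, hy]

/-- Moving chips in pairs between the vertices of `V` and the new vertices is a
principal operation. -/
theorem pairs_mem_Prin (m : V → V → ℕ) (g : V → ℕ) (s : (Σ v : V, Fin (g v)) → ℤ) :
    (Sum.elim (fun v : V => ∑ k : Fin (g v), 2 * s ⟨v, k⟩) (fun z => -2 * s z) :
      (V ⊕ Σ v : V, Fin (g v)) → ℤ) ∈ Prin (hatm m g) := by
  have hmem : ∑ z, s z • tdiv (hatm m g) {Sum.inr z} ∈ Prin (hatm m g) :=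
    sum_mem fun z _ => zsmul_mem (AddSubgroup.subset_closure (Set.mem_range_self _)) _
  convert hmem using 1
  funext x
  rcases x with v | z
  · simp only [tdiv_singleton_inr, Sum.elim_inl, Finset.sum_apply, Pi.smul_apply, smul_eq_mul,
      Fintype.sum_sigma]
    rw [Finset.sum_eq_single v]
    · exact Finset.sum_congr rfl fun k _ => by simp [mul_comm]
    · intro w _ hw
      simp [hw]
    · simp
  · simp [tdiv_singleton_inr, Finset.sum_apply, mul_comm]

theorem equivEff_hatd_sub (m : V → V → ℕ) (g : V → ℕ) (d : V → ℤ)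
    (e : (V ⊕ Σ v : V, Fin (g v)) → ℤ) (he : Effective e)
    (h : EquivEff m (d - edeg g fun v => e (Sum.inl v) + ∑ k, e (Sum.inr ⟨v, k⟩))) :
    EquivEff (hatm m g) (hatd g d - e) := by
  obtain ⟨f, hf, hp⟩ := h
  set E : V → ℤ := fun v => e (Sum.inl v) + ∑ k, e (Sum.inr ⟨v, k⟩) with hE
  let s : (Σ v : V, Fin (g v)) → ℤ := fun z => (e (Sum.inr z) + 1) / 2
  refine ⟨Sum.elim (fun v => f v + edeg g E v - e (Sum.inl v) - ∑ k : Fin (g v), 2 * s ⟨v, k⟩)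
    (fun z => 2 * s z - e (Sum.inr z)), ?_, ?_⟩
  · rintro (v | z)
    · have hodd : ∑ k, 2 * s ⟨v, k⟩ ≤ ∑ k, e (Sum.inr ⟨v, k⟩) + g v := by
        calc ∑ k, 2 * s ⟨v, k⟩ ≤ ∑ k : Fin (g v), (e (Sum.inr ⟨v, k⟩) + 1) :=
              Finset.sum_le_sum fun k _ => by simp only [s]; omega
          _ = ∑ k, e (Sum.inr ⟨v, k⟩) + g v := by simp [Finset.sum_add_distrib]
      have hdouble : ∑ k, 2 * s ⟨v, k⟩ ≤ 2 * ∑ k, e (Sum.inr ⟨v, k⟩) := by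
        rw [Finset.mul_sum]
        refine Finset.sum_le_sum fun k _ => ?_
        have := he (Sum.inr ⟨v, k⟩)
        simp only [s]
        omega
      have hfv := hf v
      have hev := he (Sum.inl v)
      simp only [Sum.elim_inl, edeg, hE]
      omega
    · simp only [Sum.elim_inr, s]
      omega
  · convert (Prin (hatm m g)).add_mem (hatd_mem_Prin m g hp) (pairs_mem_Prin m g s) using 1
    funext x
    rcases x with v | z
    · simp only [hatd, Pi.sub_apply, Pi.add_apply, Sum.elim_inl]
      ring
    · simp only [hatd, Pi.sub_apply, Pi.add_apply, Sum.elim_inr]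
      ring

/-- If for every effective divisor `e` of degree `r` on the weighted graph
`(V, m, g)` the divisor `d - e^deg` is equivalent to an effective divisor,
then `r_G(d) ≥ r`. -/
theorem stmt3 {V : Type*} [Fintype V] [DecidableEq V] [Nonempty V]
    (m : V → V → ℕ) (hsymm : ∀ v w, m v w = m w v) (hloop : ∀ v, m v v = 0)
    (hconn : Conn m) (g : V → ℕ) (d : V → ℤ) (r : ℤ) (hr : 0 ≤ r)
    (h : ∀ e : V → ℤ, Effective e → deg e = r → EquivEff m (d - edeg g e)) :
    r ≤ wrank m g d := by
  refine le_csSup (bddAbove_rank_set _ (hatm_symm m hsymm g) _) (Or.inr ⟨hr, fun e he hdeg => ?_⟩)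
  refine equivEff_hatd_sub m g d e he (h _ (fun v => ?_) ?_)
  · exact add_nonneg (he _) (Finset.sum_nonneg fun k _ => he _)
  · rw [← hdeg]
    simp [deg, Fintype.sum_sum_type, Fintype.sum_sigma, Finset.sum_add_distrib]
end

section
/- Let G be a finite connected loopless multigraph (weightless) and let δ be a divisor class on G. Then r_G(δ) = −1 if and only if there exist a vertex u and a representative d of δ such that d is u-reduced and d(u) < 0. -/
open Finset

variable {V : Type*} [Fintype V] [DecidableEq V]

/-- The Laplacian of an integer-valued function on the vertices. -/
def lap (m : V → V → ℕ) : (V → ℤ) →+ (V → ℤ) where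
  toFun f v := ∑ w, (m v w : ℤ) * (f w - f v)
  map_zero' := by ext; simp
  map_add' f g := by
    ext v
    simp only [Pi.add_apply, ← Finset.sum_add_distrib]
    exact Finset.sum_congr rfl fun w _ => by ring

theorem lap_apply {W : Type*} [Fintype W] (m : W → W → ℕ) (f : W → ℤ) (v : W) :
    lap m f v = ∑ w, (m v w : ℤ) * (f w - f v) := rfl

theorem lap_indicator (m : V → V → ℕ) (Z : Finset V) :
    lap m (fun v => if v ∈ Z then 1 else 0) = tdiv m Z := by
  ext v
  by_cases hv : v ∈ Z
  · have hZ : ∑ w ∈ Z, (m v w : ℤ) * ((if w ∈ Z then 1 else 0) - 1) = 0 :=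
      Finset.sum_eq_zero fun w hw => by simp [hw]
    rw [lap_apply, tdiv, if_pos hv, if_pos hv, dot, ← Finset.sum_compl_add_sum Z, hZ, add_zero,
      ← Finset.sum_neg_distrib]
    refine Finset.sum_congr rfl fun w hw => ?_
    simp [Finset.mem_compl.1 hw]
  · simp [lap_apply, tdiv, hv, dot]

theorem mem_prin_iff (m : V → V → ℕ) (d : V → ℤ) : d ∈ Prin m ↔ ∃ f, lap m f = d := by
  constructor
  · intro h
    have : Prin m ≤ (lap m).range := by
      rw [Prin, AddSubgroup.closure_le]
      rintro _ ⟨Z, rfl⟩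
      exact ⟨_, lap_indicator m Z⟩
    exact this h
  · rintro ⟨f, rfl⟩
    have hf : f = ∑ v, f v • fun w => if w ∈ ({v} : Finset V) then (1 : ℤ) else 0 := by
      ext w
      simp [Finset.sum_apply]
    rw [hf, map_sum]
    refine AddSubgroup.sum_mem _ fun v _ => ?_
    rw [map_zsmul, lap_indicator]
    exact AddSubgroup.zsmul_mem _ (AddSubgroup.subset_closure (Set.mem_range_self _)) _

/-- The Laplacian of a symmetric multigraph is self-adjoint. -/
theorem sum_mul_lap_comm {W : Type*} [Fintype W] (m : W → W → ℕ)
    (hsymm : ∀ v w, m v w = m w v) (f g : W → ℤ) :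
    ∑ v, f v * lap m g v = ∑ v, g v * lap m f v := by
  have key : ∑ v, ∑ w, (m v w : ℤ) * (f v * g w) = ∑ v, ∑ w, (m v w : ℤ) * (g v * f w) := by
    rw [Finset.sum_comm]
    exact Finset.sum_congr rfl fun v _ => Finset.sum_congr rfl fun w _ => by
      rw [hsymm w v]; ring
  have expand : ∀ f g : W → ℤ, ∑ v, f v * lap m g v =
      ∑ v, ∑ w, (m v w : ℤ) * (f v * g w) - ∑ v, ∑ w, (m v w : ℤ) * (f v * g v) := by
    intro f g
    simp only [lap_apply, Finset.mul_sum, ← Finset.sum_sub_distrib]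
    exact Finset.sum_congr rfl fun v _ => Finset.sum_congr rfl fun w _ => by ring
  rw [expand, expand, key]
  simp only [mul_comm (f _) (g _)]

theorem deg_lap {W : Type*} [Fintype W] (m : W → W → ℕ) (hsymm : ∀ v w, m v w = m w v)
    (f : W → ℤ) :
    deg (lap m f) = 0 := by
  have h := sum_mul_lap_comm m hsymm (fun _ => 1) f
  simpa [deg, lap_apply (f := fun _ => (1 : ℤ))] using h

theorem EquivEff.deg_nonneg {m : V → V → ℕ} (hsymm : ∀ v w, m v w = m w v) {d : V → ℤ}
    (h : EquivEff m d) : 0 ≤ deg d := by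
  obtain ⟨e, he, hde⟩ := h
  obtain ⟨f, hf⟩ := (mem_prin_iff m _).1 hde
  have h0 : deg (d - e) = 0 := hf ▸ deg_lap m hsymm f
  have h1 : 0 ≤ deg e := Finset.sum_nonneg fun v _ => he v
  simp only [deg, Pi.sub_apply, Finset.sum_sub_distrib] at h0 h1 ⊢
  omega

theorem bnrank_eq_neg_one_iff [Nonempty V] (m : V → V → ℕ) (hsymm : ∀ v w, m v w = m w v)
    (d : V → ℤ) : bnrank m d = -1 ↔ ¬ EquivEff m d := by
  obtain ⟨u⟩ := ‹Nonempty V›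
  have single : ∀ k : ℤ, 0 ≤ k → Effective (Pi.single u k) ∧ deg (Pi.single u k) = k := by
    intro k hk
    refine ⟨fun v => ?_, by simp [deg]⟩
    by_cases h : v = u
    · subst h; simpa
    · simp [h]
  constructor
  · intro h hd
    have hbdd : BddAbove ({-1} ∪ {k : ℤ | 0 ≤ k ∧
        ∀ e : V → ℤ, Effective e → deg e = k → EquivEff m (d - e)}) := by
      refine ⟨deg d, ?_⟩
      have hdeg := hd.deg_nonneg hsymm
      rintro k (rfl | ⟨hk, H⟩)
      · omega
      · have := (H _ (single k hk).1 (single k hk).2).deg_nonneg hsymm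
        have hs := (single k hk).2
        simp only [deg, Pi.sub_apply, Finset.sum_sub_distrib] at this hs ⊢
        omega
    have h0 : (0 : ℤ) ≤ bnrank m d := by
      refine le_csSup hbdd (Or.inr ⟨le_rfl, fun e he hdeg => ?_⟩)
      have : e = 0 := by
        ext v
        exact (Finset.sum_eq_zero_iff_of_nonneg fun v _ => he v).1 hdeg v (Finset.mem_univ v)
      rwa [this, sub_zero]
    omega
  · intro h
    have hempty : {k : ℤ | 0 ≤ k ∧
        ∀ e : V → ℤ, Effective e → deg e = k → EquivEff m (d - e)} = ∅ := by
      refine Set.eq_empty_iff_forall_notMem.2 ?_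
      rintro k ⟨hk, H⟩
      obtain ⟨e, he, hde⟩ := H _ (single k hk).1 (single k hk).2
      refine h ⟨e + Pi.single u k, fun v => add_nonneg (he v) ((single k hk).1 v), ?_⟩
      rwa [add_comm, ← sub_sub]
    rw [bnrank, hempty, Set.union_empty, csSup_singleton]

/-- A reduced divisor that is negative at its base point is not equivalent to an effective one. -/
theorem Reduced.not_equivEff {m : V → V → ℕ} {u : V} {d : V → ℤ} (hd : Reduced m u d)
    (hu : d u < 0) : ¬ EquivEff m d := by
  rintro ⟨e, he, hde⟩
  obtain ⟨f, hf⟩ := (mem_prin_iff m _).1 hde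
  obtain ⟨x, -, hx⟩ := Finset.exists_min_image univ f ⟨u, Finset.mem_univ u⟩
  have hval : ∀ v, d v - lap m f v = e v := fun v => by rw [hf]; simp
  set A := univ.filter fun v => f v = f x with hA
  have hle : ∀ v ∈ A, dot m v Aᶜ ≤ lap m f v := by
    intro v hv
    have hvx : f v = f x := by simpa [hA] using hv
    rw [lap_apply, dot]
    refine (Finset.sum_le_sum fun w hw => ?_).trans
      (Finset.sum_le_sum_of_subset_of_nonneg (Finset.subset_univ Aᶜ) fun w _ _ =>
        mul_nonneg (Int.natCast_nonneg _) (by have := hx w (Finset.mem_univ w); omega))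
    have hw' : f w ≠ f x := by simpa [hA] using hw
    have := hx w (Finset.mem_univ w)
    exact le_mul_of_one_le_right (Int.natCast_nonneg _) (by omega)
  by_cases huA : u ∈ A
  · have h0 : 0 ≤ dot m u Aᶜ := Finset.sum_nonneg fun w _ => Int.natCast_nonneg _
    have := hle u huA
    have := hval u
    have := he u
    omega
  · obtain ⟨v, hv, hlt⟩ := hd.2 A ⟨x, by simp [hA]⟩ huA
    have := hle v hv
    have := hval v
    have := he v
    omega

/-- In a connected multigraph there is a rank function that strictly increases along some edge
out of every vertex other than `u`, and is maximal at `u`. -/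
theorem Conn.exists_rank {W : Type*} [Fintype W] {m : W → W → ℕ}
    (hsymm : ∀ v w, m v w = m w v) (hloop : ∀ v, m v v = 0) (hconn : Conn m) (u : W) :
    ∃ r : W → ℕ, (∀ v, r v ≤ r u) ∧ ∀ v, v ≠ u → ∃ p, 0 < m v p ∧ r v < r p := by
  let G : SimpleGraph W :=
    { Adj := fun v w => 0 < m v w
      symm := ⟨fun v w h => by rwa [hsymm w v]⟩
      loopless := ⟨fun v h => by simp [hloop] at h⟩ }
  have hreach : ∀ v, G.Reachable v u := fun v =>
    (SimpleGraph.reachable_iff_reflTransGen v u).2 (hconn v u)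
  have hbd : ∀ v, G.dist v u ≤ ∑ w, G.dist w u := fun v =>
    Finset.single_le_sum (f := fun w => G.dist w u) (fun _ _ => Nat.zero_le _) (Finset.mem_univ v)
  refine ⟨fun v => ∑ w, G.dist w u - G.dist v u, fun v => by simp, fun v hv => ?_⟩
  obtain ⟨p, hp⟩ := (hreach v).exists_walk_length_eq_dist
  cases p with
  | nil => exact absurd rfl hv
  | cons h q =>
    rename_i w
    refine ⟨w, h, ?_⟩
    have := SimpleGraph.dist_le q
    have := hbd v
    simp only [SimpleGraph.Walk.length_cons] at hp
    dsimp only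
    omega

/-- A nonnegative function vanishing at `u` and strictly superharmonic elsewhere. -/
theorem Conn.exists_superharmonic {W : Type*} [Fintype W] {m : W → W → ℕ}
    (hsymm : ∀ v w, m v w = m w v) (hloop : ∀ v, m v v = 0) (hconn : Conn m) (u : W) :
    ∃ g : W → ℤ, (∀ v, 0 ≤ g v) ∧ g u = 0 ∧ ∀ v, v ≠ u → lap m g v ≤ -1 := by
  obtain ⟨r, hru, hr⟩ := hconn.exists_rank hsymm hloop u
  let M : ℤ := 1 + ∑ v, ∑ w, (m v w : ℤ)
  have hM : ∀ v, 1 + ∑ w, (m v w : ℤ) ≤ M := fun v =>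
    add_le_add_right (Finset.single_le_sum (f := fun v => ∑ w, (m v w : ℤ))
      (fun _ _ => Finset.sum_nonneg fun _ _ => Int.natCast_nonneg _) (Finset.mem_univ v)) 1
  have hM1 : 1 ≤ M := by
    refine le_trans ?_ (hM u)
    simpa using Finset.sum_nonneg fun _ _ => Int.natCast_nonneg _
  refine ⟨fun v => M ^ r u - M ^ r v, fun v => sub_nonneg.2 (pow_le_pow_right₀ hM1 (hru v)),
    sub_self _, fun v hv => ?_⟩
  obtain ⟨p, hp, hrp⟩ := hr v hv
  have hpow : M * M ^ r v ≤ M ^ r p := by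
    rw [← pow_succ']
    exact pow_le_pow_right₀ hM1 hrp
  have hpos : ∀ w, 1 ≤ M ^ r w := fun w => one_le_pow₀ hM1
  have hmp : (1 : ℤ) ≤ m v p := by exact_mod_cast hp
  have hsum : M ^ r p ≤ ∑ w, (m v w : ℤ) * M ^ r w := by
    refine le_trans ?_ (Finset.single_le_sum (f := fun w => (m v w : ℤ) * M ^ r w)
      (fun w _ => mul_nonneg (Int.natCast_nonneg _) (by linarith [hpos w])) (Finset.mem_univ p))
    exact le_mul_of_one_le_left (by linarith [hpos p]) hmp
  have heq : lap m (fun v => M ^ r u - M ^ r v) v =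
      (∑ w, (m v w : ℤ)) * M ^ r v - ∑ w, (m v w : ℤ) * M ^ r w := by
    rw [lap_apply, Finset.sum_mul, ← Finset.sum_sub_distrib]
    exact Finset.sum_congr rfl fun w _ => by ring
  rw [heq]
  have := hpos v
  nlinarith [hM v]

/-- Every divisor on a connected multigraph is equivalent to a `u`-reduced one. -/
theorem Conn.exists_reduced {m : V → V → ℕ} (hsymm : ∀ v w, m v w = m w v)
    (hloop : ∀ v, m v v = 0) (hconn : Conn m) (u : V) (d₀ : V → ℤ) :
    ∃ d, d - d₀ ∈ Prin m ∧ Reduced m u d := by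
  obtain ⟨g, hg0, hgu, hg⟩ := hconn.exists_superharmonic hsymm hloop u
  have descend : ∀ n : ℕ, ∀ d : V → ℤ, (∀ v, v ≠ u → 0 ≤ d v) → ∑ v, g v * d v < n →
      ∃ d', d' - d ∈ Prin m ∧ Reduced m u d' := by
    intro n
    induction n with
    | zero =>
      intro d hd hn
      refine absurd (Finset.sum_nonneg fun v _ => ?_) (not_le.2 hn)
      by_cases hv : v = u
      · simp [hv, hgu]
      · exact mul_nonneg (hg0 v) (hd v hv)
    | succ n ih =>
      intro d hd hn
      by_cases hred : Reduced m u d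
      · exact ⟨d, by simp, hred⟩
      obtain ⟨A, ⟨x, hxA⟩, huA, hA⟩ : ∃ A : Finset V, A.Nonempty ∧ u ∉ A ∧
          ∀ v ∈ A, dot m v Aᶜ ≤ d v := by
        simpa [Reduced, hd] using fun h => hred ⟨hd, h⟩
      have hlt : ∑ v, g v * tdiv m A v ≤ -1 := by
        rw [← lap_indicator, sum_mul_lap_comm m hsymm]
        simp only [ite_mul, one_mul, zero_mul, Finset.sum_ite_mem, Finset.univ_inter]
        have hneg : ∀ v ∈ A, lap m g v ≤ -1 := fun v hv => hg v fun h => huA (h ▸ hv)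
        rw [← Finset.add_sum_erase A _ hxA]
        have := hneg x hxA
        have := Finset.sum_nonpos fun v (hv : v ∈ A.erase x) =>
          (hneg v (Finset.mem_of_mem_erase hv)).trans (by norm_num : (-1 : ℤ) ≤ 0)
        omega
      obtain ⟨d', hd', hr⟩ := ih (d + tdiv m A) (fun v hv => by
          have h0 : 0 ≤ dot m v A := Finset.sum_nonneg fun w _ => Int.natCast_nonneg _
          have := hd v hv
          by_cases hvA : v ∈ A
          · have := hA v hvA
            simp only [Pi.add_apply, tdiv, if_pos hvA]
            omega
          · simp only [Pi.add_apply, tdiv, if_neg hvA]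
            omega) (by
          simp only [Pi.add_apply, mul_add, Finset.sum_add_distrib]
          push_cast at hn
          omega)
      refine ⟨d', ?_, hr⟩
      have := AddSubgroup.add_mem _ hd' (AddSubgroup.subset_closure ⟨A, rfl⟩ : tdiv m A ∈ Prin m)
      convert this using 1
      abel
  let c : ℤ := ∑ v, |d₀ v|
  obtain ⟨d, hd, hr⟩ := descend _ (d₀ + lap m (-c • g)) (fun v hv => by
    have h1 : |d₀ v| ≤ c :=
      Finset.single_le_sum (f := fun v => |d₀ v|) (fun _ _ => abs_nonneg _) (Finset.mem_univ v)
    have h2 := neg_abs_le (d₀ v)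
    have h3 := abs_nonneg (d₀ v)
    rw [map_zsmul]
    simp only [Pi.add_apply, Pi.smul_apply, smul_eq_mul]
    nlinarith [hg v hv]) (lt_of_le_of_lt (Int.self_le_toNat _) (Int.lt_succ _))
  refine ⟨d, ?_, hr⟩
  have := AddSubgroup.add_mem _ hd ((mem_prin_iff m _).2 ⟨-c • g, rfl⟩)
  convert this using 1
  abel

/-- `r_G(δ) = -1` iff some representative `d` of the class `δ` is `u`-reduced
for some vertex `u` with `d u < 0`. -/
theorem stmt4 {V : Type*} [Fintype V] [DecidableEq V] [Nonempty V]
    (m : V → V → ℕ) (hsymm : ∀ v w, m v w = m w v) (hloop : ∀ v, m v v = 0)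
    (hconn : Conn m) (d₀ : V → ℤ) :
    bnrank m d₀ = -1 ↔
      ∃ (u : V) (d : V → ℤ), d - d₀ ∈ Prin m ∧ Reduced m u d ∧ d u < 0 := by
  rw [bnrank_eq_neg_one_iff m hsymm]
  constructor
  · intro h
    obtain ⟨u⟩ := ‹Nonempty V›
    obtain ⟨d, hd, hr⟩ := hconn.exists_reduced hsymm hloop u d₀
    refine ⟨u, d, hd, hr, not_le.1 fun hu => h ⟨d, fun v => ?_, ?_⟩⟩
    · by_cases hv : v = u
      · rwa [hv]
      · exact hr.1 v hv
    · rw [← neg_sub]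
      exact AddSubgroup.neg_mem _ hd
  · rintro ⟨u, d, hd, hr, hu⟩ ⟨e, he, hde⟩
    refine hr.not_equivEff hu ⟨e, he, ?_⟩
    rw [← sub_add_sub_cancel d d₀ e]
    exact AddSubgroup.add_mem _ hd hde
end

section
/- Let G = (V, m) be a finite connected loopless multigraph, let u be a vertex of G, and let d be a divisor with d(v) ≥ 0 for every vertex v ≠ u. Then there exists a saturation of G with respect to u and d, i.e., a loopless multigraph G′ = (V, m′) on the same vertex set with m′ ≥ m pointwise, such that m′(v,w) = m(v,w) whenever u ∉ {v,w}, and d is u-reduced as a divisor on G′. -/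
open Finset

variable {V : Type*} [Fintype V] [DecidableEq V]

/-- Existence of a saturation: given a vertex `u` and a divisor `d` effective
away from `u`, there is a loopless multigraph `m'` on the same vertex set,
obtained from `m` by adding only edges adjacent to `u`, on which `d` is
`u`-reduced. -/
theorem stmt7 {V : Type*} [Fintype V] [DecidableEq V] [Nonempty V]
    (m : V → V → ℕ) (hsymm : ∀ v w, m v w = m w v) (hloop : ∀ v, m v v = 0)
    (hconn : Conn m) (u : V) (d : V → ℤ) (hd : ∀ v, v ≠ u → 0 ≤ d v) :
    ∃ m' : V → V → ℕ,
      (∀ v w, m' v w = m' w v) ∧ (∀ v, m' v v = 0) ∧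
      (∀ v w, m v w ≤ m' v w) ∧
      (∀ v w, u ≠ v → u ≠ w → m' v w = m v w) ∧
      Reduced m' u d := by
  refine ⟨fun v w => m v w + if v = u then (if w = u then 0 else (d w).toNat + 1)
    else if w = u then (d v).toNat + 1 else 0, ?_, ?_, ?_, ?_, hd, ?_⟩
  · intro v w
    simp only [hsymm v w]
    split_ifs <;> rfl
  · intro v
    simp only [hloop v]
    split_ifs <;> rfl
  · exact fun v w => Nat.le_add_right _ _
  · intro v w hv hw
    simp [hv.symm, hw.symm]
  · rintro A ⟨v, hv⟩ hu
    have hvu : v ≠ u := ne_of_mem_of_not_mem hv hu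
    refine ⟨v, hv, lt_of_lt_of_le ?_ (Finset.single_le_sum
      (fun w _ => Int.natCast_nonneg _) (Finset.mem_compl.mpr hu))⟩
    simp only [if_neg hvu, if_true]
    have := Int.self_le_toNat (d v)
    push_cast
    omega
end

section
/- Let G be the binary graph of genus g: the weightless loopless multigraph with two vertices v₁, v₂ joined by g+1 edges. Let a, b be integers with 0 ≤ a ≤ b ≤ g, and let d be the divisor with d(v₁) = a and d(v₂) = b. Then r_G(d) = a. -/
open Finset

variable {V : Type*} [Fintype V] [DecidableEq V]

/-- The intersection number `v · A` on a graph with two vertices. -/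
theorem dot_fin_two (m : Fin 2 → Fin 2 → ℕ) (v : Fin 2) (A : Finset (Fin 2)) :
    dot m v A = (if 0 ∈ A then (m v 0 : ℤ) else 0) + if 1 ∈ A then (m v 1 : ℤ) else 0 := by
  rw [dot, ← Finset.univ_inter A, ← Finset.sum_ite_mem, Fin.sum_univ_two]
  simp

/-- Every principal divisor of the binary graph of genus `g` is an integer multiple of
`(g + 1, -(g + 1))`. -/
theorem exists_eq_mul_of_mem_prin_binary (g : ℕ) {p : Fin 2 → ℤ}
    (hp : p ∈ Prin (fun v w : Fin 2 => if v = w then 0 else g + 1)) :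
    ∃ n : ℤ, p 0 = n * (g + 1) ∧ p 1 = -(n * (g + 1)) := by
  induction hp using AddSubgroup.closure_induction with
  | mem x hx =>
    obtain ⟨Z, rfl⟩ := hx
    by_cases h0 : (0 : Fin 2) ∈ Z <;> by_cases h1 : (1 : Fin 2) ∈ Z
    · exact ⟨0, by simp [tdiv, dot_fin_two, h0, h1]⟩
    · exact ⟨-1, by simp [tdiv, dot_fin_two, h0, h1]⟩
    · exact ⟨1, by simp [tdiv, dot_fin_two, h0, h1]⟩
    · exact ⟨0, by simp [tdiv, dot_fin_two, h0, h1]⟩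
  | zero => exact ⟨0, by simp⟩
  | add x y _ _ hx hy =>
    obtain ⟨n, hn0, hn1⟩ := hx
    obtain ⟨k, hk0, hk1⟩ := hy
    exact ⟨n + k, by simp only [Pi.add_apply, hn0, hk0]; ring,
      by simp only [Pi.add_apply, hn1, hk1]; ring⟩
  | neg x _ hx =>
    obtain ⟨n, hn0, hn1⟩ := hx
    exact ⟨-n, by simp only [Pi.neg_apply, hn0]; ring, by simp only [Pi.neg_apply, hn1]; ring⟩

/-- On the binary graph of genus `g` (two vertices joined by `g+1` edges), the
divisor `(a, b)` with `0 ≤ a ≤ b ≤ g` has combinatorial rank `a`. -/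
theorem stmt12 (g : ℕ) (a b : ℤ) (ha : 0 ≤ a) (hab : a ≤ b) (hb : b ≤ (g : ℤ)) :
    bnrank (fun v w : Fin 2 => if v = w then 0 else g + 1)
      (fun v : Fin 2 => if v = 0 then a else b) = a := by
  refine IsGreatest.csSup_eq ⟨Or.inr ⟨ha, fun e he hdeg => ?_⟩, ?_⟩
  · refine ⟨_, fun v => ?_, by rw [sub_self]; exact zero_mem _⟩
    have h0 := he 0
    have h1 := he 1
    rw [deg, Fin.sum_univ_two] at hdeg
    fin_cases v <;> simp <;> linarith
  · rintro k (hk | ⟨-, hk⟩)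
    · rw [Set.mem_singleton_iff.mp hk]
      linarith
    · by_contra! hak
      obtain ⟨f, hf, hmem⟩ := hk (fun v => if v = 0 then a + 1 else k - a - 1)
        (fun v => by fin_cases v <;> simp <;> linarith) (by simp [deg, Fin.sum_univ_two])
      obtain ⟨n, hn0, hn1⟩ := exists_eq_mul_of_mem_prin_binary g hmem
      have h0 := hf 0
      have h1 := hf 1
      simp only [Pi.sub_apply, if_true, one_ne_zero, if_false] at hn0 hn1
      have hn : n < 0 := by
        by_contra! hn
        nlinarith [mul_nonneg hn (by positivity : (0 : ℤ) ≤ g + 1)]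
      nlinarith [mul_le_mul_of_nonneg_right (Int.add_one_le_iff.mpr hn)
        (by positivity : (0 : ℤ) ≤ g + 1)]
end

section
/- Let G be the binary graph of genus g: the weightless loopless multigraph with two vertices v₁, v₂ joined by g+1 edges. Let a, b be integers with 0 ≤ a ≤ b, b ≥ g + 1, and a + b ≤ 2g − 2, and let d be the divisor with d(v₁) = a and d(v₂) = b. Then r_G(d) = a + b − g. -/
open Finset

variable {V : Type*} [Fintype V] [DecidableEq V]

/-- A principal divisor on the graph with two vertices joined by `n` edges has degree zero, and
its values are multiples of `n`. -/
theorem prin_binary {n : ℕ} {f : Fin 2 → ℤ}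
    (hf : f ∈ Prin (fun v w : Fin 2 => if v = w then 0 else n)) :
    (n : ℤ) ∣ f 0 ∧ f 0 + f 1 = 0 := by
  induction hf using AddSubgroup.closure_induction with
  | mem x hx =>
    obtain ⟨Z, rfl⟩ := hx
    have key : ∀ v : Fin 2, ∀ A : Finset (Fin 2),
        dot (fun v w : Fin 2 => if v = w then 0 else n) v A = if 1 - v ∈ A then (n : ℤ) else 0 := by
      intro v A
      rw [dot, ← Finset.sum_filter_add_sum_filter_not A (fun w => w = 1 - v)]
      fin_cases v <;> fin_cases A <;> simp [Finset.sum_filter]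
    simp only [tdiv, key]
    by_cases h0 : (0 : Fin 2) ∈ Z <;> by_cases h1 : (1 : Fin 2) ∈ Z <;> simp [h0, h1]
  | zero => simp
  | add x y _ _ hx hy =>
    refine ⟨dvd_add hx.1 hy.1, ?_⟩
    simp only [Pi.add_apply]
    linarith [hx.2, hy.2]
  | neg x _ hx =>
    refine ⟨(dvd_neg).2 hx.1, ?_⟩
    simp only [Pi.neg_apply]
    linarith [hx.2]

/-- Firing the first vertex of the graph with two vertices joined by `n` edges. -/
theorem binary_fire_mem_prin (n : ℕ) :
    (fun v : Fin 2 => if v = 0 then -(n : ℤ) else n) ∈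
      Prin (fun v w : Fin 2 => if v = w then 0 else n) := by
  refine AddSubgroup.subset_closure ⟨{0}, ?_⟩
  have hc : ({0} : Finset (Fin 2))ᶜ = {1} := by decide
  funext v
  fin_cases v <;> simp [tdiv, dot, hc]

/-- On the binary graph of genus `g` (two vertices joined by `g+1` edges), the
divisor `(a, b)` with `0 ≤ a ≤ b`, `b ≥ g + 1` and `a + b ≤ 2g - 2` has
combinatorial rank `a + b - g`. -/
theorem stmt13 (g : ℕ) (a b : ℤ) (ha : 0 ≤ a) (hab : a ≤ b)
    (hb : (g : ℤ) + 1 ≤ b) (hd : a + b ≤ 2 * (g : ℤ) - 2) :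
    bnrank (fun v w : Fin 2 => if v = w then 0 else g + 1)
      (fun v : Fin 2 => if v = 0 then a else b) = a + b - (g : ℤ) := by
  refine IsGreatest.csSup_eq ⟨Or.inr ⟨by linarith, fun e he hk => ?_⟩, ?_⟩
  · have h0 := he 0
    have h1 := he 1
    simp only [deg, Fin.sum_univ_two] at hk
    by_cases hle : e 0 ≤ a
    · refine ⟨_, ?_, by rw [sub_self]; exact zero_mem _⟩
      intro v
      fin_cases v
      · simpa using hle
      · simp only [Pi.sub_apply, Fin.mk_one, one_ne_zero, if_false]
        linarith
    · push Not at hle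
      refine ⟨fun v => if v = 0 then a - e 0 + (g + 1) else b - e 1 - (g + 1), ?_, ?_⟩
      · intro v
        fin_cases v <;> simp <;> linarith
      · convert binary_fire_mem_prin (g + 1) using 1
        funext v
        fin_cases v <;> simp
  · rintro k (rfl | ⟨hk, h⟩)
    · linarith
    by_contra! hlt
    obtain ⟨f, hf, hp⟩ := h (fun v => if v = 0 then a + 1 else k - a - 1)
      (fun v => by fin_cases v <;> simp <;> linarith) (by simp [deg, Fin.sum_univ_two])
    obtain ⟨⟨c, hc⟩, hs⟩ := prin_binary hp
    have h0 := hf 0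
    have h1 := hf 1
    simp at hc hs
    have hpos : c < 0 := by
      by_contra! h
      nlinarith
    nlinarith
end
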